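/- Let λ = (λ_1 ≥ … ≥ λ_ℓ > 0) be a partition of n, let m ≥ ℓ, and let θ_{α,k} ∈ ℕ (1 ≤ α ≤ ℓ, 1 ≤ k ≤ m) satisfy Σ_{k=1}^{m} θ_{α,k} = λ_α for every α. Set λ^{(k)}_α := Σ_{j=1}^{k} θ_{α,j} and λ^{(k)}_{ℓ+1} := 0. Let T be the filling of the Young diagram of λ whose entry at box (α,i) (1 ≤ i ≤ λ_α) is the unique k with λ^{(k−1)}_α < i ≤ λ^{(k)}_α, and let D be the filling whose every entry in row α equals α. Then the rational function in ζ over ℚ(q,t) given by ζ ↦ γ_T(ζ)/γ_D(ζ) is regular at ζ = t, and its value at ζ = t equals ∏_{k=1}^{m} ∏_{1≤α≤β≤ℓ} [ (q^{λ^{(k−1)}_α − λ^{(k−1)}_β} t^{β−α+1}; q)_{θ_{α,k}} · (q^{λ^{(k−1)}_α − λ^{(k)}_{β+1} + 1} t^{β−α}; q)_{θ_{α,k}} ] / [ (q^{λ^{(k−1)}_α − λ^{(k−1)}_β + 1} t^{β−α}; q)_{θ_{α,k}} · (q^{λ^{(k−1)}_α − λ^{(k)}_{β+1}} t^{β−α+1};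 q)_{θ_{α,k}} ]. -/

import Mathlib

noncomputable section

/-- The field ℚ(q,t) of rational functions in two independent indeterminates over ℚ. -/
abbrev K : Type := FractionRing (MvPolynomial (Fin 2) ℚ)

def q : K := algebraMap (MvPolynomial (Fin 2) ℚ) K (MvPolynomial.X 0)
def t : K := algebraMap (MvPolynomial (Fin 2) ℚ) K (MvPolynomial.X 1)

/-- The field ℚ(q,t)(ζ) of rational functions in ζ over ℚ(q,t). -/
abbrev R : Type := RatFunc K

/-- `q` as an element of ℚ(q,t)(ζ). -/
def Qv : R := RatFunc.C q
/-- `t` as an element of ℚ(q,t)(ζ). -/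
def Tv : R := RatFunc.C t
/-- the variable ζ. -/
def Zv : R := RatFunc.X

/-- The q-Pochhammer symbol `(u;q)_n = ∏_{i=0}^{n-1} (1 - qⁱ u)`. -/
def qPoch (q u : K) (n : ℕ) : K := ∏ i ∈ Finset.range n, (1 - q ^ i * u)

/-- `γ_{a,b}(z,w;q,t)`, depending on the comparison of the indices `a`, `b`. -/
def gam {F : Type*} [Field F] (q t : F) (a b : ℕ) (zz ww : F) : F :=
  if a = b then (zz - t * ww) * (zz - t⁻¹ * ww) / (zz - ww) ^ 2
  else if a < b then
    (zz - q⁻¹ * ww) * (zz - t * ww) * (zz - q * t⁻¹ * ww) / (zz - ww) ^ 3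
  else (zz - q * ww) * (zz - t⁻¹ * ww) * (zz - q⁻¹ * t * ww) / (zz - ww) ^ 3

/-- The boxes `(α,i)`, `1 ≤ α ≤ ℓ`, `1 ≤ i ≤ λ_α`, of the Young diagram of λ. -/
def boxes (l : ℕ) (lam : ℕ → ℕ) : Finset ((_ : ℕ) × ℕ) :=
  (Finset.Icc 1 l).sigma fun α => Finset.Icc 1 (lam α)

/-- `γ_S(ζ) = ∏_{(α,i) ≺ (β,j)} γ_{S(α,i),S(β,j)}(q^{-(i-1)} ζ^{α-1}, q^{-(j-1)} ζ^{β-1})`,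
the product over pairs of boxes in reading order, for a filling `S` of λ. -/
def gfill (l : ℕ) (lam : ℕ → ℕ) (S : ℕ → ℕ → ℕ) : R :=
  ∏ b1 ∈ boxes l lam,
    ∏ b2 ∈ (boxes l lam).filter fun b2 =>
        b1.1 < b2.1 ∨ (b1.1 = b2.1 ∧ b1.2 < b2.2),
      gam Qv Tv (S b1.1 b1.2) (S b2.1 b2.2)
        (Qv⁻¹ ^ (b1.2 - 1) * Zv ^ (b1.1 - 1)) (Qv⁻¹ ^ (b2.2 - 1) * Zv ^ (b2.1 - 1))

/-- The partial sums `λ^{(k)}_α = Σ_{j=1}^{k} θ_{α,j}`. -/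
def pl (θ : ℕ → ℕ → ℕ) (α k : ℕ) : ℕ := ∑ j ∈ Finset.Icc 1 k, θ α j

/-- The partial sums extended by `λ^{(k)}_α := 0` for `α > ℓ`. -/
def plE (l : ℕ) (θ : ℕ → ℕ → ℕ) (α k : ℕ) : ℕ := if α ≤ l then pl θ α k else 0

/-- The filling `T` of λ: the entry at box `(α,i)` is the unique `k` with
`λ^{(k-1)}_α < i ≤ λ^{(k)}_α`, computed as `#{k' ∈ {0,…,m-1} : λ^{(k')}_α < i}`. -/
def Tfill (m : ℕ) (θ : ℕ → ℕ → ℕ) (α i : ℕ) : ℕ :=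
  ((Finset.range m).filter fun k => pl θ α k < i).card

section Field

variable {F : Type*} [Field F]

/-- The elementary factor `1 - qᵃ tᶜ y`. -/
def fac (q t : F) (a c : ℤ) (y : F) : F := 1 - q ^ a * t ^ c * y

lemma gam_mul_left (q t : F) (a b : ℕ) {z : F} (hz : z ≠ 0) (x : F) :
    gam q t a b z (z * x) = gam q t a b 1 x := by
  have key : ∀ c : F, z - c * (z * x) = z * (1 - c * x) := fun c => by ring
  have key' : z - z * x = z * (1 - x) := by ring
  unfold gam
  simp only [key, key']
  split_ifs
  · rw [show z * (1 - t * x) * (z * (1 - t⁻¹ * x)) = z ^ 2 * ((1 - t * x) * (1 - t⁻¹ * x)) by ring,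
      mul_pow, mul_div_mul_left _ _ (pow_ne_zero 2 hz)]
  · rw [show ∀ A B C : F, z * A * (z * B) * (z * C) = z ^ 3 * (A * B * C) by intros; ring,
      mul_pow, mul_div_mul_left _ _ (pow_ne_zero 3 hz)]
  · rw [show ∀ A B C : F, z * A * (z * B) * (z * C) = z ^ 3 * (A * B * C) by intros; ring,
      mul_pow, mul_div_mul_left _ _ (pow_ne_zero 3 hz)]

section Factors

variable {q : F} (t y : F) (e : ℤ)

lemma gam_eq_of_eq {a b : ℕ} (h : a = b) : gam q t a b 1 (q ^ e * y) =
    fac q t e 1 y * fac q t e (-1) y / fac q t e 0 y ^ 2 := by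
  simp only [gam, if_pos h, fac, zpow_one, zpow_neg, zpow_zero]
  congr 1 <;> ring

lemma gam_eq_of_lt (hq : q ≠ 0) {a b : ℕ} (h : a < b) : gam q t a b 1 (q ^ e * y) =
    fac q t (e - 1) 0 y * fac q t e 1 y * fac q t (e + 1) (-1) y / fac q t e 0 y ^ 3 := by
  simp only [gam, if_neg h.ne, if_pos h, fac, zpow_one, zpow_neg, zpow_zero, zpow_sub_one₀ hq,
    zpow_add_one₀ hq]
  congr 1 <;> ring

lemma gam_eq_of_gt (hq : q ≠ 0) {a b : ℕ} (h : b < a) : gam q t a b 1 (q ^ e * y) =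
    fac q t (e + 1) 0 y * fac q t e (-1) y * fac q t (e - 1) 1 y / fac q t e 0 y ^ 3 := by
  simp only [gam, if_neg h.ne', if_neg h.not_gt, fac, zpow_one, zpow_neg, zpow_zero,
    zpow_sub_one₀ hq, zpow_add_one₀ hq]
  congr 1 <;> ring

lemma gam_div_gam_of_lt (hq : q ≠ 0) (H : ∀ a c : ℤ, fac q t a c y ≠ 0) (a b : ℕ) {α β : ℕ} (h : α < β) :
    gam q t a b 1 (q ^ e * y) / gam q t α β 1 (q ^ e * y) =
      (if b ≤ a then fac q t e 0 y / fac q t (e - 1) 0 y *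
        (fac q t e (-1) y / fac q t (e + 1) (-1) y) else 1) *
      (if b < a then fac q t (e + 1) 0 y / fac q t e 0 y *
        (fac q t (e - 1) 1 y / fac q t e 1 y) else 1) := by
  have h0 := H e 0
  have h1 := H (e - 1) 0
  have h2 := H (e + 1) (-1)
  have h3 := H e 1
  rw [gam_eq_of_lt t y e hq h]
  rcases lt_trichotomy a b with hab | hab | hab
  · rw [gam_eq_of_lt t y e hq hab, if_neg hab.not_ge, if_neg hab.not_gt]
    field_simp
  · rw [gam_eq_of_eq t y e hab, if_pos hab.ge, if_neg hab.not_gt]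
    field_simp
  · rw [gam_eq_of_gt t y e hq hab, if_pos hab.le, if_pos hab]
    field_simp

lemma gam_div_gam_self (hq : q ≠ 0) (h0 : fac q t e 0 y ≠ 0) (h1 : fac q t e 1 y ≠ 0)
    (h2 : fac q t e (-1) y ≠ 0) {a b : ℕ} (hab : a ≤ b) (α : ℕ) :
    gam q t a b 1 (q ^ e * y) / gam q t α α 1 (q ^ e * y) =
      (if b ≤ a then 1 else fac q t (e - 1) 0 y / fac q t e 0 y *
        (fac q t (e + 1) (-1) y / fac q t e (-1) y)) := by
  rw [gam_eq_of_eq t y e rfl]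
  rcases hab.lt_or_eq with hab | hab
  · rw [gam_eq_of_lt t y e hq hab, if_neg hab.not_ge]
    field_simp
  · rw [gam_eq_of_eq t y e hab, if_pos hab.ge]
    field_simp

end Factors

lemma prod_div_succ_range (f : ℤ → F) (hf : ∀ a, f a ≠ 0) (i : ℤ) (B : ℕ) :
    ∏ j ∈ Finset.range B, f (i - j) / f (i - j - 1) = f i / f (i - B) := by
  induction B with
  | zero => simp [div_self (hf i)]
  | succ B ih =>
    rw [Finset.prod_range_succ, ih, div_mul_div_cancel₀ (hf _)]
    push_cast
    ring_nf

lemma prod_div_pred_range (f : ℤ → F) (hf : ∀ a, f a ≠ 0) (i : ℤ) (B : ℕ) :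
    ∏ j ∈ Finset.range B, f (i - j) / f (i - j + 1) = f (i + 1 - B) / f (i + 1) := by
  rw [← inv_inj, ← Finset.prod_inv_distrib, inv_div,
    ← prod_div_succ_range f hf (i + 1) B]
  refine Finset.prod_congr rfl fun j _ => ?_
  rw [inv_div]
  ring_nf

lemma prod_ite_lt_range (f : ℕ → F) {B N : ℕ} (h : B ≤ N) :
    ∏ j ∈ Finset.range N, (if j < B then f j else 1) = ∏ j ∈ Finset.range B, f j := by
  rw [← Finset.prod_filter]
  congr 1
  ext j
  simp only [Finset.mem_filter, Finset.mem_range]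
  omega

/-- The contribution of a box of row `α` paired with all boxes of a lower row. -/
def rowFactor (q t y : F) (i b c : ℤ) : F :=
  fac q t i 0 y / fac q t (i - b) 0 y * (fac q t (i + 1 - b) (-1) y / fac q t (i + 1) (-1) y) *
    (fac q t (i + 1) 0 y / fac q t (i + 1 - c) 0 y * (fac q t (i - c) 1 y / fac q t i 1 y))

lemma prod_gam_div_gam_of_lt {q t : F} (hq : q ≠ 0) (y : F)
    (H : ∀ a c : ℤ, fac q t a c y ≠ 0) (a : ℕ) (S : ℕ → ℕ) {α β : ℕ} (h : α < β) (i : ℕ)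
    {N b c : ℕ} (hb : b ≤ N) (hc : c ≤ N) (hSb : ∀ j < N, S j ≤ a ↔ j < b)
    (hSc : ∀ j < N, S j < a ↔ j < c) :
    (∏ j ∈ Finset.range N, gam q t a (S j) 1 (q ^ ((i : ℤ) - j) * y)) /
      (∏ j ∈ Finset.range N, gam q t α β 1 (q ^ ((i : ℤ) - j) * y)) =
    rowFactor q t y i b c := by
  rw [← Finset.prod_div_distrib]
  have step : ∀ j ∈ Finset.range N,
      gam q t a (S j) 1 (q ^ ((i : ℤ) - j) * y) / gam q t α β 1 (q ^ ((i : ℤ) - j) * y) =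
      (if j < b then fac q t ((i : ℤ) - j) 0 y / fac q t ((i : ℤ) - j - 1) 0 y *
        (fac q t ((i : ℤ) - j) (-1) y / fac q t ((i : ℤ) - j + 1) (-1) y) else 1) *
      (if j < c then fac q t ((i : ℤ) + 1 - j) 0 y / fac q t ((i : ℤ) + 1 - j - 1) 0 y *
        (fac q t ((i : ℤ) - 1 - j) 1 y / fac q t ((i : ℤ) - 1 - j + 1) 1 y) else 1) := by
    intro j hj
    rw [Finset.mem_range] at hj
    rw [gam_div_gam_of_lt t y _ hq H _ _ h]
    simp only [hSb j hj, hSc j hj]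
    ring_nf
  rw [Finset.prod_congr rfl step, Finset.prod_mul_distrib, prod_ite_lt_range _ hb,
    prod_ite_lt_range _ hc, Finset.prod_mul_distrib, Finset.prod_mul_distrib,
    prod_div_succ_range (fun a => fac q t a 0 y) (fun a => H a 0),
    prod_div_pred_range (fun a => fac q t a (-1) y) (fun a => H a (-1)),
    prod_div_succ_range (fun a => fac q t a 0 y) (fun a => H a 0),
    prod_div_pred_range (fun a => fac q t a 1 y) (fun a => H a 1), rowFactor]
  ring_nf

/-- The contribution of a box paired with all later boxes of its row. -/
def selfFactor (q t : F) (i a N : ℤ) : F :=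
  fac q t (i - N) 0 1 / fac q t (i - a) 0 1 *
    (fac q t (i + 1 - a) (-1) 1 / fac q t (i + 1 - N) (-1) 1)

lemma prod_Ico_fac {q t : F} (H : ∀ a c : ℤ, a ≠ 0 ∨ c ≠ 0 → fac q t a c 1 ≠ 0) {i a N : ℕ}
    (hi : i < a) (h : a ≤ N) :
    ∏ j ∈ Finset.Ico a N, (fac q t ((i : ℤ) - j - 1) 0 1 / fac q t ((i : ℤ) - j) 0 1 *
        (fac q t ((i : ℤ) - j + 1) (-1) 1 / fac q t ((i : ℤ) - j) (-1) 1)) =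
      selfFactor q t i a N := by
  induction N, h using Nat.le_induction with
  | base =>
    rw [Finset.Ico_self, Finset.prod_empty, selfFactor, div_self (H _ _ (by omega)),
      div_self (H _ _ (by omega)), one_mul]
  | succ N hN ih =>
    rw [Finset.prod_Ico_succ_top hN, ih, selfFactor, selfFactor]
    have h1 := H ((i : ℤ) - a) 0 (by omega)
    have h2 := H ((i : ℤ) + 1 - N) (-1) (by omega)
    have h3 := H ((i : ℤ) - N) 0 (by omega)
    have h4 := H ((i : ℤ) - N) (-1) (by omega)
    push_cast
    rw [show (i : ℤ) - (N + 1) = i - N - 1 by ring, show (i : ℤ) + 1 - (N + 1) = i - N by ring,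
      show (i : ℤ) - N + 1 = i + 1 - N by ring]
    field_simp

lemma prod_gam_div_gam_self {q t : F} (hq : q ≠ 0)
    (H : ∀ a c : ℤ, a ≠ 0 ∨ c ≠ 0 → fac q t a c 1 ≠ 0) (k : ℕ) (S : ℕ → ℕ) (α : ℕ) {i N a : ℕ}
    (hi : i < a) (ha : a ≤ N) (hS : ∀ j ∈ Finset.Ico (i + 1) N, k ≤ S j)
    (hSa : ∀ j < N, S j ≤ k ↔ j < a) :
    (∏ j ∈ Finset.Ico (i + 1) N, gam q t k (S j) 1 (q ^ ((i : ℤ) - j) * 1)) /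
      (∏ j ∈ Finset.Ico (i + 1) N, gam q t α α 1 (q ^ ((i : ℤ) - j) * 1)) =
    selfFactor q t i a N := by
  rw [← prod_Ico_fac H hi ha, ← Finset.prod_div_distrib,
    ← Finset.prod_Ico_consecutive _ (show i + 1 ≤ a from hi) ha]
  have key : ∀ j ∈ Finset.Ico (i + 1) N,
      gam q t k (S j) 1 (q ^ ((i : ℤ) - j) * 1) / gam q t α α 1 (q ^ ((i : ℤ) - j) * 1) =
      if S j ≤ k then 1 else fac q t ((i : ℤ) - j - 1) 0 1 / fac q t ((i : ℤ) - j) 0 1 *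
        (fac q t ((i : ℤ) - j + 1) (-1) 1 / fac q t ((i : ℤ) - j) (-1) 1) := by
    intro j hj
    have := Finset.mem_Ico.1 hj
    exact gam_div_gam_self t 1 _ hq (H _ _ (by omega)) (H _ _ (by omega)) (H _ _ (by omega))
      (hS j hj) α
  rw [Finset.prod_eq_one, one_mul]
  · refine Finset.prod_congr rfl fun j hj => ?_
    rw [Finset.mem_Ico] at hj
    rw [key j (Finset.mem_Ico.2 (by omega)), if_neg]
    rw [hSa j hj.2]
    omega
  · intro j hj
    rw [Finset.mem_Ico] at hj
    rw [key j (Finset.mem_Ico.2 (by omega)), if_pos]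
    rw [hSa j (by omega)]
    exact hj.2

end Field

lemma prod_Icc_one_eq_prod_range {M : Type*} [CommMonoid M] (f : ℕ → M) (n : ℕ) :
    ∏ i ∈ Finset.Icc 1 n, f i = ∏ i ∈ Finset.range n, f (i + 1) := by
  induction n with
  | zero => simp
  | succ n ih => rw [Finset.prod_Icc_succ_top (by omega), ih, Finset.prod_range_succ]

lemma pl_mono (θ : ℕ → ℕ → ℕ) (α : ℕ) : Monotone (pl θ α) := fun _ _ h =>
  Finset.sum_le_sum_of_subset (Finset.Icc_subset_Icc_right h)

lemma pl_succ (θ : ℕ → ℕ → ℕ) (α k : ℕ) : pl θ α (k + 1) = pl θ α k + θ α (k + 1) :=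
  Finset.sum_Icc_succ_top (by omega) _

lemma prod_range_pl {M : Type*} [CommMonoid M] (θ : ℕ → ℕ → ℕ) (α m : ℕ) (f : ℕ → M) :
    ∏ i ∈ Finset.range (pl θ α m), f i =
      ∏ k ∈ Finset.Icc 1 m, ∏ s ∈ Finset.range (θ α k), f (pl θ α (k - 1) + s) := by
  induction m with
  | zero => simp [pl]
  | succ m ih =>
    rw [Finset.prod_Icc_succ_top (by omega), ← ih, pl_succ, Finset.prod_range_add]
    simp

lemma Tfill_le_iff {m : ℕ} (θ : ℕ → ℕ → ℕ) (α : ℕ) {i k : ℕ} (hk : k ≤ m) (hi : i ≤ pl θ α m) :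
    Tfill m θ α i ≤ k ↔ i ≤ pl θ α k := by
  unfold Tfill
  constructor
  · contrapose!
    intro h
    have hkm : k ≠ m := by rintro rfl; omega
    rw [← Nat.succ_le_iff, ← Finset.card_range k.succ]
    refine Finset.card_le_card fun j hj => ?_
    rw [Finset.mem_range] at hj
    have := pl_mono θ α (show j ≤ k by omega)
    rw [Finset.mem_filter, Finset.mem_range]
    omega
  · intro h
    refine (Finset.card_le_card fun j hj => ?_).trans (Finset.card_range k).le
    rw [Finset.mem_filter] at hj
    rw [Finset.mem_range]
    by_contra hjk
    have := pl_mono θ α (show k ≤ j by omega)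
    omega

lemma Tfill_lt_iff {m : ℕ} (θ : ℕ → ℕ → ℕ) (α : ℕ) {i k : ℕ} (hk1 : 1 ≤ k) (hk : k ≤ m)
    (hi : i ≤ pl θ α m) : Tfill m θ α i < k ↔ i ≤ pl θ α (k - 1) := by
  rw [← Tfill_le_iff θ α (by omega) hi]
  omega

lemma Tfill_mono (m : ℕ) (θ : ℕ → ℕ → ℕ) (α : ℕ) : Monotone (Tfill m θ α) := fun _ _ h =>
  Finset.card_le_card (Finset.monotone_filter_right _ fun _ _ hk => lt_of_lt_of_le hk h)

lemma Tfill_eq {m : ℕ} (θ : ℕ → ℕ → ℕ) (α : ℕ) {s k : ℕ} (hk1 : 1 ≤ k) (hk : k ≤ m)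
    (hs : s < θ α k) : Tfill m θ α (pl θ α (k - 1) + s + 1) = k := by
  obtain ⟨k, rfl⟩ : ∃ k', k = k' + 1 := ⟨k - 1, by omega⟩
  have h1 := pl_succ θ α k
  have h2 := pl_mono θ α hk
  rw [Nat.add_sub_cancel]
  apply le_antisymm
  · rw [Tfill_le_iff θ α hk (by omega)]
    omega
  · rw [← not_lt, Tfill_lt_iff θ α hk1 hk (by omega), Nat.add_sub_cancel]
    omega

lemma prod_boxes_eq {M : Type*} [CommMonoid M] (l : ℕ) (lam : ℕ → ℕ)
    (f : (_ : ℕ) × ℕ → (_ : ℕ) × ℕ → M) :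
    ∏ b1 ∈ boxes l lam, ∏ b2 ∈ (boxes l lam).filter fun b2 =>
        b1.1 < b2.1 ∨ (b1.1 = b2.1 ∧ b1.2 < b2.2), f b1 b2 =
      ∏ α ∈ Finset.Icc 1 l, ∏ i ∈ Finset.range (lam α),
        ((∏ j ∈ Finset.Ico (i + 1) (lam α), f ⟨α, i + 1⟩ ⟨α, j + 1⟩) *
          ∏ β ∈ Finset.Icc (α + 1) l, ∏ j ∈ Finset.range (lam β), f ⟨α, i + 1⟩ ⟨β, j + 1⟩) := by
  simp only [boxes, Finset.prod_filter, Finset.prod_sigma, prod_Icc_one_eq_prod_range _ (lam _)]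
  refine Finset.prod_congr rfl fun α hα => Finset.prod_congr rfl fun i hi => ?_
  rw [Finset.mem_Icc] at hα
  rw [Finset.mem_range] at hi
  have hsub : insert α (Finset.Icc (α + 1) l) ⊆ Finset.Icc 1 l := by
    intro β
    simp only [Finset.mem_insert, Finset.mem_Icc]
    omega
  rw [← Finset.prod_subset hsub, Finset.prod_insert (by simp)]
  · congr 1
    · rw [← Finset.prod_filter]
      refine Finset.prod_congr ?_ fun _ _ => rfl
      ext j
      simp only [Finset.mem_filter, Finset.mem_range, Finset.mem_Ico, lt_self_iff_false, true_and,
        false_or]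
      omega
    · refine Finset.prod_congr rfl fun β hβ => Finset.prod_congr rfl fun j _ => if_pos ?_
      rw [Finset.mem_Icc] at hβ
      omega
  · intro β hβ hβ'
    simp only [Finset.mem_insert, Finset.mem_Icc] at hβ hβ'
    refine Finset.prod_eq_one fun j _ => if_neg ?_
    omega

lemma q_ne_zero : q ≠ 0 := by simp [q]

lemma t_ne_zero : t ≠ 0 := by simp [t]

lemma Qv_ne_zero : Qv ≠ 0 := by simp [Qv, q]

lemma Zv_ne_zero : Zv ≠ 0 := RatFunc.X_ne_zero

lemma gam_box (a b α β i j : ℕ) (hα : 1 ≤ α) (hβ : α ≤ β) :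
    gam Qv Tv a b (Qv⁻¹ ^ (i + 1 - 1) * Zv ^ (α - 1)) (Qv⁻¹ ^ (j + 1 - 1) * Zv ^ (β - 1)) =
      gam Qv Tv a b 1 (Qv ^ ((i : ℤ) - j) * Zv ^ (β - α)) := by
  have hq := Qv_ne_zero
  rw [← gam_mul_left Qv Tv a b (z := Qv⁻¹ ^ (i + 1 - 1) * Zv ^ (α - 1))
    (mul_ne_zero (pow_ne_zero _ (inv_ne_zero hq)) (pow_ne_zero _ Zv_ne_zero))]
  congr 1
  rw [show β - 1 = (α - 1) + (β - α) by omega, pow_add, zpow_sub₀ hq, zpow_natCast, zpow_natCast,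
    Nat.add_sub_cancel, Nat.add_sub_cancel, inv_pow, inv_pow]
  field_simp

lemma gfill_eq (l : ℕ) (lam : ℕ → ℕ) (S : ℕ → ℕ → ℕ) :
    gfill l lam S = ∏ α ∈ Finset.Icc 1 l, ∏ i ∈ Finset.range (lam α),
      ((∏ j ∈ Finset.Ico (i + 1) (lam α),
          gam Qv Tv (S α (i + 1)) (S α (j + 1)) 1 (Qv ^ ((i : ℤ) - j) * 1)) *
        ∏ β ∈ Finset.Icc (α + 1) l, ∏ j ∈ Finset.range (lam β),
          gam Qv Tv (S α (i + 1)) (S β (j + 1)) 1 (Qv ^ ((i : ℤ) - j) * Zv ^ (β - α))) := by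
  rw [gfill, prod_boxes_eq]
  refine Finset.prod_congr rfl fun α hα => Finset.prod_congr rfl fun i _ => ?_
  have hα := (Finset.mem_Icc.1 hα).1
  congr 1
  · refine Finset.prod_congr rfl fun j _ => ?_
    rw [gam_box _ _ _ _ _ _ hα le_rfl, Nat.sub_self, pow_zero]
  · refine Finset.prod_congr rfl fun β hβ => Finset.prod_congr rfl fun j _ => ?_
    have hβ : α ≤ β := by
      rw [Finset.mem_Icc] at hβ
      omega
    exact gam_box _ _ _ _ _ _ hα hβ

lemma q_zpow_mul_t_zpow_ne_one {a c : ℤ} (h : a ≠ 0 ∨ c ≠ 0) : q ^ a * t ^ c ≠ 1 := by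
  have hq := q_ne_zero
  have ht := t_ne_zero
  intro hac
  have key : q ^ a.toNat * t ^ c.toNat = q ^ (-a).toNat * t ^ (-c).toNat := by
    have ha : a = a.toNat - (-a).toNat := by omega
    have hc : c = c.toNat - (-c).toNat := by omega
    rw [ha, hc, zpow_sub₀ hq, zpow_sub₀ ht] at hac
    simp only [zpow_natCast] at hac
    field_simp at hac
    exact hac
  simp only [q, t, ← map_pow, ← map_mul] at key
  have key := IsFractionRing.injective (MvPolynomial (Fin 2) ℚ) K key
  simp only [MvPolynomial.X_pow_eq_monomial, MvPolynomial.monomial_mul, mul_one] at key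
  have key := MvPolynomial.monomial_left_injective one_ne_zero key
  have h0 := DFunLike.congr_fun key 0
  have h1 := DFunLike.congr_fun key 1
  simp at h0 h1
  omega

lemma fac_one_ne_zero {a c : ℤ} (h : a ≠ 0 ∨ c ≠ 0) : fac q t a c 1 ≠ 0 := by
  rw [fac, mul_one]
  exact sub_ne_zero.2 (q_zpow_mul_t_zpow_ne_one h).symm

lemma fac_C_one (a c : ℤ) : fac Qv Tv a c 1 = RatFunc.C (fac q t a c 1) := by
  simp [fac, Qv, Tv]

lemma fac_Zv_pow_ne_zero (a c : ℤ) {d : ℕ} (hd : d ≠ 0) : fac Qv Tv a c (Zv ^ d) ≠ 0 := by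
  intro h
  have hne : q ^ a * t ^ c ≠ 0 :=
    mul_ne_zero (zpow_ne_zero _ q_ne_zero) (zpow_ne_zero _ t_ne_zero)
  have h1 : (1 - Polynomial.C (q ^ a * t ^ c) * Polynomial.X ^ d : Polynomial K) = 0 := by
    apply RatFunc.algebraMap_injective K
    simpa [fac, Qv, Tv, Zv] using h
  have := congrArg (fun p => Polynomial.coeff p d) h1
  rw [Polynomial.coeff_sub, Polynomial.coeff_C_mul_X_pow, if_pos rfl, Polynomial.coeff_one,
    if_neg hd, zero_sub, Polynomial.coeff_zero, neg_eq_zero] at this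
  exact hne this

/-- `f` is regular at `ζ = t`, with value `v` there. -/
def HasValue (f : R) (v : K) : Prop :=
  ∃ p r : Polynomial K, r.eval t ≠ 0 ∧ f * algebraMap (Polynomial K) R r = algebraMap _ R p ∧
    p.eval t = v * r.eval t

namespace HasValue

lemma C (c : K) : HasValue (RatFunc.C c) c := ⟨Polynomial.C c, 1, by simp, by simp, by simp⟩

lemma fac_Zv_pow (a c : ℤ) (d : ℕ) :
    HasValue (fac Qv Tv a c (Zv ^ d)) (fac q t a c (t ^ d)) :=
  ⟨1 - Polynomial.C (q ^ a * t ^ c) * Polynomial.X ^ d, 1, by simp, by simp [fac, Qv, Tv, Zv],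
    by simp [fac]⟩

lemma mul {f g : R} {v w : K} (hf : HasValue f v) (hg : HasValue g w) :
    HasValue (f * g) (v * w) := by
  obtain ⟨p, r, hr, h, he⟩ := hf
  obtain ⟨p', r', hr', h', he'⟩ := hg
  refine ⟨p * p', r * r', ?_, ?_, ?_⟩
  · rw [Polynomial.eval_mul]
    exact mul_ne_zero hr hr'
  · rw [map_mul, map_mul, ← h, ← h']
    ring
  · rw [Polynomial.eval_mul, Polynomial.eval_mul, he, he']
    ring

lemma inv {f : R} {v : K} (hf : HasValue f v) (hv : v ≠ 0) : HasValue f⁻¹ v⁻¹ := by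
  obtain ⟨p, r, hr, h, he⟩ := hf
  have hp : p.eval t ≠ 0 := he ▸ mul_ne_zero hv hr
  refine ⟨r, p, hp, ?_, ?_⟩
  · rw [← h, ← mul_assoc, inv_mul_cancel₀, one_mul]
    rintro rfl
    rw [zero_mul, eq_comm, map_eq_zero_iff _ (RatFunc.algebraMap_injective K)] at h
    exact hp (by rw [h, Polynomial.eval_zero])
  · rw [he, inv_mul_cancel_left₀ hv]

lemma div {f g : R} {v w : K} (hf : HasValue f v) (hg : HasValue g w) (hw : w ≠ 0) :
    HasValue (f / g) (v / w) := by
  rw [div_eq_mul_inv, div_eq_mul_inv]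
  exact hf.mul (hg.inv hw)

lemma prod {ι : Type*} (s : Finset ι) {f : ι → R} {v : ι → K}
    (h : ∀ i ∈ s, HasValue (f i) (v i)) : HasValue (∏ i ∈ s, f i) (∏ i ∈ s, v i) := by
  classical
  induction s using Finset.induction_on with
  | empty => simpa using C 1
  | insert i s hi ih =>
    rw [Finset.prod_insert hi, Finset.prod_insert hi]
    exact (h i (Finset.mem_insert_self i s)).mul
      (ih fun j hj => h j (Finset.mem_insert_of_mem hj))

lemma denom_ne_zero_and_eval_eq {f : R} {v : K} (hf : HasValue f v) :
    Polynomial.eval t f.denom ≠ 0 ∧ RatFunc.eval (RingHom.id K) t f = v := by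
  obtain ⟨p, r, hr, h, he⟩ := hf
  have hr0 : r ≠ 0 := by
    rintro rfl
    exact hr Polynomial.eval_zero
  have hr0' : algebraMap (Polynomial K) R r ≠ 0 := by
    rwa [Ne, map_eq_zero_iff _ (RatFunc.algebraMap_injective K)]
  have hf : f = algebraMap _ R p / algebraMap _ R r := eq_div_of_mul_eq hr0' h
  have hd : Polynomial.eval t f.denom ≠ 0 := by
    obtain ⟨s, hs⟩ : f.denom ∣ r := hf ▸ RatFunc.denom_div_dvd p r
    intro h0
    rw [hs, Polynomial.eval_mul, h0, zero_mul] at hr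
    exact hr rfl
  refine ⟨hd, ?_⟩
  have hnum : f.num * r = p * f.denom := (RatFunc.num_mul_eq_mul_denom_iff hr0).2 hf
  have := congrArg (Polynomial.eval t) hnum
  rw [Polynomial.eval_mul, Polynomial.eval_mul, he] at this
  rw [RatFunc.eval, Polynomial.eval₂_id, Polynomial.eval₂_id, div_eq_iff hd]
  apply mul_right_cancel₀ hr
  rw [this]
  ring

end HasValue

lemma fac_t_pow (a c : ℤ) (d : ℕ) : fac q t a c (t ^ d) = fac q t a (c + d) 1 := by
  rw [fac, fac, zpow_add₀ t_ne_zero, zpow_natCast]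
  ring

lemma hasValue_rowFactor (i : ℕ) (b c : ℤ) {d : ℕ} (hd : d ≠ 0) :
    HasValue (rowFactor Qv Tv (Zv ^ d) i b c) (rowFactor q t (t ^ d) i b c) := by
  have h : ∀ a e : ℤ, a ≠ 0 ∨ e + d ≠ 0 → fac q t a e (t ^ d) ≠ 0 := fun a e hae => by
    rw [fac_t_pow]
    exact fac_one_ne_zero hae
  exact (((HasValue.fac_Zv_pow _ _ _).div (.fac_Zv_pow _ _ _) (h _ _ (by omega))).mul
    ((HasValue.fac_Zv_pow _ _ _).div (.fac_Zv_pow _ _ _) (h _ _ (by omega)))).mul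
    (((HasValue.fac_Zv_pow _ _ _).div (.fac_Zv_pow _ _ _) (h _ _ (by omega))).mul
    ((HasValue.fac_Zv_pow _ _ _).div (.fac_Zv_pow _ _ _) (h _ _ (by omega))))

lemma hasValue_selfFactor (i a N : ℤ) :
    HasValue (selfFactor Qv Tv i a N) (selfFactor q t i a N) := by
  have : selfFactor Qv Tv i a N = RatFunc.C (selfFactor q t i a N) := by
    simp only [selfFactor, fac_C_one, map_mul, map_div₀]
  rw [this]
  exact .C _

lemma fac_neg_div_fac_neg (s : ℕ) :
    fac q t (-s) (-1) 1 / fac q t (-s - 1) 0 1 = q / t * (fac q t s 1 1 / fac q t (s + 1) 0 1) := by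
  have h1 : fac q t (-s - 1) 0 1 ≠ 0 := fac_one_ne_zero (by omega)
  have h2 : fac q t (s + 1) 0 1 ≠ 0 := fac_one_ne_zero (by omega)
  have hq := q_ne_zero
  have ht := t_ne_zero
  rw [← mul_div_assoc, div_eq_div_iff h1 h2, div_mul_eq_mul_div, div_mul_eq_mul_div, eq_div_iff ht]
  simp only [fac, zpow_add₀ hq, zpow_sub₀ hq, zpow_neg, zpow_natCast, zpow_one, zpow_zero]
  field_simp
  ring

lemma prod_fac_neg_div_fac_neg (n : ℕ) :
    ∏ s ∈ Finset.range n, fac q t (s + 1 - n) (-1) 1 / fac q t (s - n) 0 1 =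
      (q / t) ^ n * ∏ s ∈ Finset.range n, fac q t s 1 1 / fac q t (s + 1) 0 1 := by
  rw [← Finset.prod_range_reflect, ← Finset.card_range n, ← Finset.prod_const, Finset.card_range,
    ← Finset.prod_mul_distrib]
  refine Finset.prod_congr rfl fun s hs => ?_
  rw [Finset.mem_range] at hs
  rw [← fac_neg_div_fac_neg, show ((n - 1 - s : ℕ) : ℤ) + 1 - n = -s by omega,
    show ((n - 1 - s : ℕ) : ℤ) - n = -s - 1 by omega]

/-- The product of all contributions from pairs of boxes in one row at `ζ = t`. -/
lemma prod_selfFactor (m : ℕ) (θ : ℕ → ℕ → ℕ) (α : ℕ) :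
    ∏ k ∈ Finset.Icc 1 m, ∏ s ∈ Finset.range (θ α k),
      selfFactor q t ((pl θ α (k - 1) + s : ℕ) : ℤ) (pl θ α k) (pl θ α m) =
    ∏ k ∈ Finset.Icc 1 m, ∏ s ∈ Finset.range (θ α k),
      (fac q t ((pl θ α (k - 1) + s : ℕ) + 1) 0 1 / fac q t ((pl θ α (k - 1) + s : ℕ)) 1 1 *
        (fac q t s 1 1 / fac q t (s + 1) 0 1)) := by
  have hqt : q / t ≠ 0 := div_ne_zero q_ne_zero t_ne_zero
  have hblock : ∀ k ∈ Finset.Icc 1 m, ∏ s ∈ Finset.range (θ α k),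
      fac q t (((pl θ α (k - 1) + s : ℕ) : ℤ) + 1 - pl θ α k) (-1) 1 /
        fac q t (((pl θ α (k - 1) + s : ℕ) : ℤ) - pl θ α k) 0 1 =
      (q / t) ^ θ α k * ∏ s ∈ Finset.range (θ α k), fac q t s 1 1 / fac q t (s + 1) 0 1 := by
    intro k hk
    rw [← prod_fac_neg_div_fac_neg]
    obtain ⟨k, rfl⟩ : ∃ k', k = k' + 1 := ⟨k - 1, by rw [Finset.mem_Icc] at hk; omega⟩
    refine Finset.prod_congr rfl fun s _ => ?_
    rw [pl_succ, Nat.add_sub_cancel]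
    congr 2 <;> push_cast <;> ring
  have hrow := prod_fac_neg_div_fac_neg (pl θ α m)
  rw [prod_range_pl θ α m (fun i => fac q t (i + 1 - pl θ α m) (-1) 1 / fac q t (i - pl θ α m) 0 1),
    prod_range_pl θ α m (fun i => fac q t i 1 1 / fac q t (i + 1) 0 1)] at hrow
  have hsplit : ∀ i a N : ℤ, selfFactor q t i a N =
      fac q t (i + 1 - a) (-1) 1 / fac q t (i - a) 0 1 *
        (fac q t (i + 1 - N) (-1) 1 / fac q t (i - N) 0 1)⁻¹ := fun i a N => by
    rw [selfFactor, inv_div]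
    ring
  have hinv : ∀ i : ℤ, fac q t (i + 1) 0 1 / fac q t i 1 1 =
      (fac q t i 1 1 / fac q t (i + 1) 0 1)⁻¹ := fun i => (inv_div _ _).symm
  simp only [hsplit, hinv, Finset.prod_mul_distrib, Finset.prod_inv_distrib]
  rw [hrow, Finset.prod_congr rfl hblock, Finset.prod_mul_distrib, Finset.prod_pow_eq_pow_sum,
    show ∑ k ∈ Finset.Icc 1 m, θ α k = pl θ α m from rfl, mul_inv]
  have := pow_ne_zero (pl θ α m) hqt
  generalize (q / t) ^ pl θ α m = u at *
  field_simp

/-- The contributions from boxes in lower rows telescope at `ζ = t`. -/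
lemma prod_rowFactor (i s α L : ℕ) (b c : ℕ → ℤ) (hc : (i : ℤ) - c α = s) (hL : α ≤ L) :
    fac q t (i + 1) 0 1 / fac q t i 1 1 * (fac q t s 1 1 / fac q t (s + 1) 0 1) *
        ∏ β ∈ Finset.Icc (α + 1) L, rowFactor q t (t ^ (β - α)) i (b β) (c β) =
      (∏ β ∈ Finset.Icc α L,
        fac q t (i - c β) (β - α + 1) 1 / fac q t (i + 1 - c β) (β - α) 1) *
      (∏ β ∈ Finset.Ico α L,
        fac q t (i + 1 - b (β + 1)) (β - α) 1 / fac q t (i - b (β + 1)) (β - α + 1) 1) *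
      (fac q t (i + 1) (L - α) 1 / fac q t i (L - α + 1) 1) := by
  induction L, hL using Nat.le_induction with
  | base =>
    rw [Finset.Icc_self, Finset.Ico_self, Finset.Icc_eq_empty (by omega), Finset.prod_singleton, hc,
      show (i : ℤ) + 1 - c α = s + 1 by omega, sub_self, zero_add]
    simp only [Finset.prod_empty]
    ring
  | succ L hL ih =>
    rw [Finset.prod_Icc_succ_top (by omega), Finset.prod_Icc_succ_top (by omega),
      Finset.prod_Ico_succ_top hL, ← mul_assoc, ih, rowFactor]
    simp only [fac_t_pow]
    have h1 : fac q t i (L + 1 - α) 1 ≠ 0 := fac_one_ne_zero (by omega)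
    have h2 : fac q t (i + 1) (L - α) 1 ≠ 0 := fac_one_ne_zero (by omega)
    rw [show ((L + 1 - α : ℕ) : ℤ) = L + 1 - α by omega]
    push_cast
    rw [show (-1 : ℤ) + (L + 1 - α) = L - α by ring, show (0 : ℤ) + (L + 1 - α) = L + 1 - α by ring,
      show (1 : ℤ) + (L + 1 - α) = L + 1 - α + 1 by ring, show (L : ℤ) - α + 1 = L + 1 - α by ring]
    have cancel : ∀ {P Q x y A B C D E F : K}, x ≠ 0 → y ≠ 0 →
        P * Q * (x / y) * (y * B * (A * x⁻¹) * (C * D * (E * F))) =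
          P * (E * D) * (Q * (A * B)) * (C * F) := fun hx hy => by
      field_simp
    simpa only [div_eq_mul_inv] using cancel h2 h1

lemma qPoch_eq (a c : ℤ) (n : ℕ) :
    qPoch q (q ^ a * t ^ c) n = ∏ s ∈ Finset.range n, fac q t (a + s) c 1 := by
  refine Finset.prod_congr rfl fun s _ => ?_
  rw [fac, zpow_add₀ q_ne_zero, zpow_natCast]
  ring

/-- The quotient `γ_T / γ_D`, box by box. -/
lemma gfill_div_gfill (l m : ℕ) (lam : ℕ → ℕ) (θ : ℕ → ℕ → ℕ)
    (hθ : ∀ α ∈ Finset.Icc 1 l, pl θ α m = lam α) :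
    (gfill l lam (Tfill m θ) / gfill l lam fun α _ => α) =
      ∏ α ∈ Finset.Icc 1 l, ∏ k ∈ Finset.Icc 1 m, ∏ s ∈ Finset.range (θ α k),
        (selfFactor Qv Tv ((pl θ α (k - 1) + s : ℕ) : ℤ) (pl θ α k) (pl θ α m) *
          ∏ β ∈ Finset.Icc (α + 1) l, rowFactor Qv Tv (Zv ^ (β - α))
            ((pl θ α (k - 1) + s : ℕ) : ℤ) (pl θ β k) (pl θ β (k - 1))) := by
  rw [gfill_eq, gfill_eq, ← Finset.prod_div_distrib]
  refine Finset.prod_congr rfl fun α hα => ?_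
  rw [← Finset.prod_div_distrib, ← hθ α hα, prod_range_pl]
  refine Finset.prod_congr rfl fun k hk => Finset.prod_congr rfl fun s hs => ?_
  rw [Finset.mem_Icc] at hk
  rw [Finset.mem_range] at hs
  have hlt : pl θ α (k - 1) + s < pl θ α k := by
    obtain ⟨k, rfl⟩ : ∃ k', k = k' + 1 := ⟨k - 1, by omega⟩
    rw [pl_succ, Nat.add_sub_cancel]
    omega
  rw [mul_div_mul_comm, Tfill_eq θ α hk.1 hk.2 hs]
  congr 1
  · refine prod_gam_div_gam_self Qv_ne_zero (fun a c hac => ?_) k (fun j => Tfill m θ α (j + 1)) α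
      hlt (pl_mono θ α hk.2) (fun j hj => ?_) (fun j hj => ?_)
    · rw [fac_C_one]
      simpa using fac_one_ne_zero hac
    · rw [Finset.mem_Ico] at hj
      conv_lhs => rw [← Tfill_eq θ α hk.1 hk.2 hs]
      exact Tfill_mono m θ α (by omega)
    · rw [Tfill_le_iff θ α hk.2 hj, Nat.succ_le_iff]
  · rw [← Finset.prod_div_distrib]
    refine Finset.prod_congr rfl fun β hβ => ?_
    rw [Finset.mem_Icc] at hα hβ
    rw [← hθ β (Finset.mem_Icc.2 (by omega))]
    refine prod_gam_div_gam_of_lt Qv_ne_zero _ (fun a c => fac_Zv_pow_ne_zero a c (by omega)) k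
      (fun j => Tfill m θ β (j + 1)) (by omega) _ (pl_mono θ β hk.2) (pl_mono θ β (by omega))
      (fun j hj => ?_) (fun j hj => ?_)
    · rw [Tfill_le_iff θ β hk.2 hj, Nat.succ_le_iff]
    · rw [Tfill_lt_iff θ β hk.1 hk.2 hj, Nat.succ_le_iff]

/-- `γ_T(ζ)/γ_D(ζ)` is regular at ζ = t (its reduced denominator
does not vanish at `t`), and its value there is the displayed q-Pochhammer
product (which equals Macdonald's `ψ_T(q,t)`). -/
theorem stmt8 (n l m : ℕ) (lam : ℕ → ℕ) (θ : ℕ → ℕ → ℕ)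
    (hl : 1 ≤ l) (hm : l ≤ m)
    (hpos : ∀ α ∈ Finset.Icc 1 l, 0 < lam α)
    (hanti : ∀ α β, 1 ≤ α → α ≤ β → β ≤ l → lam β ≤ lam α)
    (hsum : ∑ α ∈ Finset.Icc 1 l, lam α = n)
    (hθ : ∀ α ∈ Finset.Icc 1 l, ∑ k ∈ Finset.Icc 1 m, θ α k = lam α) :
    Polynomial.eval t
        (gfill l lam (Tfill m θ) / gfill l lam fun α _ => α).denom ≠ 0
    ∧ RatFunc.eval (RingHom.id K) t
        (gfill l lam (Tfill m θ) / gfill l lam fun α _ => α)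
      = ∏ k ∈ Finset.Icc 1 m, ∏ α ∈ Finset.Icc 1 l, ∏ β ∈ Finset.Icc α l,
          (qPoch q (q ^ ((pl θ α (k - 1) : ℤ) - (pl θ β (k - 1) : ℤ)) *
                t ^ ((β : ℤ) - α + 1)) (θ α k) *
              qPoch q (q ^ ((pl θ α (k - 1) : ℤ) - (plE l θ (β + 1) k : ℤ) + 1) *
                t ^ ((β : ℤ) - α)) (θ α k)) /
            (qPoch q (q ^ ((pl θ α (k - 1) : ℤ) - (pl θ β (k - 1) : ℤ) + 1) *
                t ^ ((β : ℤ) - α)) (θ α k) *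
              qPoch q (q ^ ((pl θ α (k - 1) : ℤ) - (plE l θ (β + 1) k : ℤ)) *
                t ^ ((β : ℤ) - α + 1)) (θ α k)) := by
  have hθ' : ∀ α ∈ Finset.Icc 1 l, pl θ α m = lam α := hθ
  have hval := HasValue.prod (Finset.Icc 1 l) fun α _ => HasValue.prod (Finset.Icc 1 m) fun k _ =>
    HasValue.prod (Finset.range (θ α k)) fun s _ =>
      (hasValue_selfFactor ((pl θ α (k - 1) + s : ℕ) : ℤ) (pl θ α k) (pl θ α m)).mul
        (HasValue.prod (Finset.Icc (α + 1) l) fun β hβ =>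
          hasValue_rowFactor (pl θ α (k - 1) + s) (pl θ β k) (pl θ β (k - 1))
            (d := β - α) (by rw [Finset.mem_Icc] at hβ; omega))
  rw [← gfill_div_gfill l m lam θ hθ'] at hval
  obtain ⟨hd, he⟩ := hval.denom_ne_zero_and_eval_eq
  refine ⟨hd, he.trans ?_⟩
  rw [Finset.prod_comm (s := Finset.Icc 1 m)]
  refine Finset.prod_congr rfl fun α hα => ?_
  rw [Finset.mem_Icc] at hα
  simp only [Finset.prod_mul_distrib]
  rw [prod_selfFactor]
  simp only [← Finset.prod_mul_distrib]
  refine Finset.prod_congr rfl fun k _ => ?_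
  simp only [qPoch_eq, ← Finset.prod_mul_distrib, ← Finset.prod_div_distrib]
  rw [Finset.prod_comm]
  refine Finset.prod_congr rfl fun s _ => ?_
  rw [prod_rowFactor _ s α l (fun β => pl θ β k) (fun β => pl θ β (k - 1))
    (by push_cast; ring) hα.2]
  simp only [mul_div_mul_comm, Finset.prod_mul_distrib]
  rw [mul_assoc]
  congr 1
  · refine Finset.prod_congr rfl fun β _ => ?_
    push_cast
    congr 2 <;> ring
  · have hlast : (plE l θ (l + 1) k : ℤ) = 0 := by simp [plE]
    rw [← Finset.Ico_succ_right_eq_Icc, Nat.succ_eq_succ, Finset.prod_Ico_succ_top hα.2, hlast]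
    congr 1
    · refine Finset.prod_congr rfl fun β hβ => ?_
      rw [Finset.mem_Ico] at hβ
      rw [plE, if_pos (by omega)]
      push_cast
      congr 2 <;> ring
    · push_cast
      congr 2; ring

end
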